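/- arXiv:2508.02585 — 5 statements merged into one kernel-verified Lean document; each statement's English description precedes it below -/
import Mathlib

section
/- Let p ≥ 2 and K ≥ 0 be integers, let α ∈ (0,1), and let B > 0 satisfy p + K + 1 ≤ α·B². Then ∫_{{l ∈ ℝ^p : ‖l‖ > B}} (2π)^{-p/2} exp(-‖l‖²/2) ‖l‖^K dl ≤ (1/(1-α)) · B^{p+K-2} · exp(-B²/2) / (p-2)!!, where (p-2)!! denotes the double factorial of p-2. -/
open MeasureTheory Real

lemma Nat.doubleFactorial_le_Gamma_mul_two_rpow (n : ℕ) :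
    (Nat.doubleFactorial n : ℝ) ≤ Real.Gamma (n / 2 + 1) * 2 ^ ((n : ℝ) / 2) := by
  induction n using Nat.twoStepInduction with
  | zero => simp
  | one =>
    have h1 : Real.Gamma (1 / 2 + 1) = 1 / 2 * √π := by
      rw [Real.Gamma_add_one (by norm_num), Real.Gamma_one_half_eq]
    have h2 : (2 : ℝ) ≤ √π * √2 := by
      rw [← Real.sqrt_mul pi_pos.le]
      exact Real.le_sqrt_of_sq_le (by linarith [pi_gt_three])
    simp only [Nat.doubleFactorial, Nat.cast_one, h1, ← Real.sqrt_eq_rpow]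
    linarith
  | more n ih _ =>
    have e : ((n + 2 : ℕ) : ℝ) / 2 = n / 2 + 1 := by push_cast; ring
    rw [e, Real.Gamma_add_one (by positivity), Real.rpow_add_one (by norm_num),
      Nat.doubleFactorial]
    push_cast
    calc ((n : ℝ) + 2) * (Nat.doubleFactorial n : ℝ)
        ≤ (n + 2) * (Real.Gamma (n / 2 + 1) * 2 ^ ((n : ℝ) / 2)) := by gcongr
      _ = _ := by ring

lemma integral_Ioi_pow_mul_exp_neg_sq_div_two_le (n : ℕ) {α B : ℝ} (hα : α < 1) (hB : 0 < B)
    (h : n ≤ α * B ^ 2) :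
    ∫ r in Set.Ioi B, r ^ (n + 1) * rexp (-r ^ 2 / 2)
      ≤ 1 / (1 - α) * (B ^ n * rexp (-B ^ 2 / 2)) := by
  have hα0 : 0 ≤ α := nonneg_of_mul_nonneg_left ((Nat.cast_nonneg n).trans h) (by positivity)
  have h1 : 0 < 1 - α := by linarith
  set F' : ℝ → ℝ := fun r => r ^ (n + 1) * rexp (-r ^ 2 / 2)
    - n * r ^ (n - 1) * rexp (-r ^ 2 / 2)
  have hF (r : ℝ) : HasDerivAt (fun r : ℝ => -(r ^ n * rexp (-r ^ 2 / 2))) (F' r) r := by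
    have he : HasDerivAt (fun r : ℝ => rexp (-r ^ 2 / 2)) (rexp (-r ^ 2 / 2) * (-r)) r := by
      have := ((hasDerivAt_pow 2 r).fun_neg.div_const 2).exp
      exact this.congr_deriv (by push_cast; ring)
    exact ((hasDerivAt_pow n r).fun_mul he).fun_neg.congr_deriv (by simp only [F']; ring)
  have hle (r : ℝ) (hr : r ∈ Set.Ioi B) :
      r ^ (n + 1) * rexp (-r ^ 2 / 2) ≤ 1 / (1 - α) * F' r := by
    have hr0 : 0 < r := hB.trans hr
    have hr2 : (n : ℝ) ≤ α * r ^ 2 := h.trans (by gcongr; exact le_of_lt hr)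
    have hp : n * r ^ (n - 1) ≤ α * r ^ (n + 1) := by
      cases n with
      | zero => simp; positivity
      | succ k =>
        calc ((k + 1 : ℕ) : ℝ) * r ^ k ≤ α * r ^ 2 * r ^ k := by gcongr
          _ = _ := by ring
    rw [one_div, ← div_eq_inv_mul, le_div_iff₀ h1]
    have := mul_le_mul_of_nonneg_right hp (exp_pos (-r ^ 2 / 2)).le
    simp only [F']
    linarith
  have hnn (r : ℝ) (hr : r ∈ Set.Ioi B) : 0 ≤ F' r := by
    have hr0 : 0 < r := hB.trans hr
    have := (show 0 ≤ r ^ (n + 1) * rexp (-r ^ 2 / 2) by positivity).trans (hle r hr)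
    exact nonneg_of_mul_nonneg_right this (by positivity)
  have hlim : Filter.Tendsto (fun r : ℝ => -(r ^ n * rexp (-r ^ 2 / 2))) Filter.atTop (nhds 0) := by
    have := ((rpow_mul_exp_neg_mul_sq_isLittleO_exp_neg (b := 1 / 2) (by norm_num) n).trans_tendsto
      (Real.tendsto_exp_comp_nhds_zero.mpr
        (Filter.tendsto_id.const_mul_atTop_of_neg (by norm_num)))).neg
    simp only [rpow_natCast, neg_zero] at this
    refine this.congr fun r => ?_
    ring_nf
  have hint := integrableOn_Ioi_deriv_of_nonneg (hF B).continuousAt.continuousWithinAt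
    (fun r _ => hF r) hnn hlim
  have hval := integral_Ioi_of_hasDerivAt_of_nonneg (hF B).continuousAt.continuousWithinAt
    (fun r _ => hF r) hnn hlim
  calc _ ≤ ∫ r in Set.Ioi B, 1 / (1 - α) * F' r := by
        refine integral_mono_of_nonneg ?_ (hint.const_mul _) ?_
        · filter_upwards [ae_restrict_mem measurableSet_Ioi] with r hr
          have hr0 : 0 < r := hB.trans hr
          simp only [Pi.zero_apply]
          positivity
        · filter_upwards [ae_restrict_mem measurableSet_Ioi] with r hr using hle r hr
    _ = _ := by rw [integral_const_mul, hval]; ring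

lemma EuclideanSpace.mul_volume_real_ball_mul_two_pi_rpow_le {p : ℕ} (hp : 2 ≤ p) :
    p * volume.real (Metric.ball (0 : EuclideanSpace ℝ (Fin p)) 1) * (2 * π) ^ (-(p : ℝ) / 2)
      ≤ 1 / (Nat.doubleFactorial (p - 2) : ℝ) := by
  have : Nonempty (Fin p) := ⟨⟨0, by omega⟩⟩
  have hG : 0 < Real.Gamma ((p : ℝ) / 2 + 1) := Real.Gamma_pos_of_pos (by positivity)
  have hdf := Nat.doubleFactorial_le_Gamma_mul_two_rpow p
  have hrec : (Nat.doubleFactorial p : ℝ) = p * Nat.doubleFactorial (p - 2) := by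
    obtain ⟨q, rfl⟩ := Nat.exists_eq_add_of_le' hp
    simp [Nat.doubleFactorial]
  have hd : (0 : ℝ) < Nat.doubleFactorial (p - 2) := by
    exact_mod_cast Nat.doubleFactorial_pos _
  have hs : √π ^ p = π ^ ((p : ℝ) / 2) := by
    rw [Real.sqrt_eq_rpow, ← Real.rpow_mul_natCast pi_pos.le]; ring_nf
  rw [measureReal_def, EuclideanSpace.volume_ball]
  simp only [Fintype.card_fin, ENNReal.ofReal_one, one_pow, one_mul]
  rw [ENNReal.toReal_ofReal (by positivity), hs, neg_div, Real.rpow_neg (by positivity),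
    Real.mul_rpow (by norm_num) pi_pos.le, le_div_iff₀ hd]
  rw [hrec] at hdf
  have hπ : (0 : ℝ) < π ^ ((p : ℝ) / 2) := by positivity
  have h2 : (0 : ℝ) < 2 ^ ((p : ℝ) / 2) := by positivity
  rw [show (p : ℝ) * (π ^ ((p : ℝ) / 2) / Real.Gamma (p / 2 + 1)) *
      (2 ^ ((p : ℝ) / 2) * π ^ ((p : ℝ) / 2))⁻¹ * (Nat.doubleFactorial (p - 2) : ℝ) =
      p * Nat.doubleFactorial (p - 2) / (Real.Gamma (p / 2 + 1) * 2 ^ ((p : ℝ) / 2)) by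
    field_simp]
  exact div_le_one_of_le₀ hdf (by positivity)

/-- Upper-bound half of the tail moment control lemma for the p-dimensional
standard normal distribution. -/
theorem gaussian_tail_moment_upper (p K : ℕ) (hp : 2 ≤ p) (α B : ℝ)
    (hα0 : 0 < α) (hα1 : α < 1) (hB : 0 < B)
    (h : (p : ℝ) + K + 1 ≤ α * B ^ 2) :
    ∫ l in {l : EuclideanSpace ℝ (Fin p) | B < ‖l‖},
        (2 * π) ^ (-(p : ℝ) / 2) * Real.exp (-‖l‖ ^ 2 / 2) * ‖l‖ ^ K
      ≤ (1 / (1 - α)) * B ^ (p + K - 2) * Real.exp (-B ^ 2 / 2) /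
        (Nat.doubleFactorial (p - 2) : ℝ) := by
  have : Nonempty (Fin p) := ⟨⟨0, by omega⟩⟩
  have hm : MeasurableSet {l : EuclideanSpace ℝ (Fin p) | B < ‖l‖} :=
    measurableSet_lt measurable_const measurable_norm
  set c : ℝ := (2 * π) ^ (-(p : ℝ) / 2)
  have hpolar := integral_fun_norm_addHaar (volume : Measure (EuclideanSpace ℝ (Fin p)))
    ((Set.Ioi B).indicator fun r => c * rexp (-r ^ 2 / 2) * r ^ K)
  have hrad : ∫ r in Set.Ioi (0 : ℝ), r ^ (p - 1) •
      (Set.Ioi B).indicator (fun r => c * rexp (-r ^ 2 / 2) * r ^ K) r =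
      c * ∫ r in Set.Ioi B, r ^ (p + K - 2 + 1) * rexp (-r ^ 2 / 2) := by
    have hinter : Set.Ioi B = Set.Ioi 0 ∩ Set.Ioi B := by
      rw [Set.Ioi_inter_Ioi, sup_eq_right.mpr hB.le]
    conv_rhs => rw [← integral_const_mul, hinter, ← setIntegral_indicator measurableSet_Ioi]
    congr 1 with r
    simp only [Set.indicator_apply]
    split_ifs
    swap
    · simp
    rw [show p + K - 2 + 1 = (p - 1) + K by omega, pow_add, smul_eq_mul]
    ring
  have htail := integral_Ioi_pow_mul_exp_neg_sq_div_two_le (p + K - 2) hα1 hB <| by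
    rw [Nat.cast_sub (by omega)]
    push_cast
    linarith
  have hconst := EuclideanSpace.mul_volume_real_ball_mul_two_pi_rpow_le hp
  rw [← integral_indicator hm]
  calc _ = ∫ l : EuclideanSpace ℝ (Fin p),
        (Set.Ioi B).indicator (fun r => c * rexp (-r ^ 2 / 2) * r ^ K) ‖l‖ := rfl
    _ = p * volume.real (Metric.ball (0 : EuclideanSpace ℝ (Fin p)) 1) * c *
        ∫ r in Set.Ioi B, r ^ (p + K - 2 + 1) * rexp (-r ^ 2 / 2) := by
      rw [hpolar, finrank_euclideanSpace_fin, hrad, nsmul_eq_mul, smul_eq_mul]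
      ring
    _ ≤ 1 / (Nat.doubleFactorial (p - 2) : ℝ) *
        (1 / (1 - α) * (B ^ (p + K - 2) * rexp (-B ^ 2 / 2))) := by
      refine mul_le_mul hconst htail ?_ (by positivity)
      refine setIntegral_nonneg measurableSet_Ioi fun r hr => ?_
      have hr0 : 0 < r := hB.trans hr
      positivity
    _ = _ := by ring
end

section
/- Let p ≥ 2 and K ≥ 0 be integers and let B > 0. Then ∫_{{l ∈ ℝ^p : ‖l‖ > B}} (2π)^{-p/2} exp(-‖l‖²/2) ‖l‖^K dl ≥ √(2/π) · B^{p+K-2} · exp(-B²/2) / (p-2)!!, where (p-2)!! denotes the double factorial of p-2. -/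
open MeasureTheory Real

/-- An upper bound on the Gamma function at half-integers by double factorials. -/
lemma sqrt_two_pow_mul_Gamma_le_doubleFactorial (q : ℕ) :
    √(2 / π) * (√2 ^ (q + 2) * Gamma (((q + 2 : ℕ) : ℝ) / 2)) ≤ 2 * (q.doubleFactorial : ℝ) := by
  induction q using Nat.twoStepInduction with
  | zero =>
    have h : √(2 / π) ≤ 1 := by
      rw [sqrt_le_one, div_le_one pi_pos]
      exact two_le_pi
    norm_num [Nat.doubleFactorial]
    simpa using h
  | one =>
    have hG : Gamma (3 / 2) = 1 / 2 * √π := by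
      rw [show (3 / 2 : ℝ) = 1 / 2 + 1 by norm_num, Gamma_add_one (by norm_num),
        Gamma_one_half_eq]
    have h2 : √2 * √2 = (2 : ℝ) := mul_self_sqrt (by norm_num)
    have hpi : √π ≠ 0 := (sqrt_pos.2 pi_pos).ne'
    norm_num [Nat.doubleFactorial]
    rw [hG]
    apply le_of_eq
    field_simp
    linear_combination (√2 * √2 + 2) * h2
  | more q ih _ =>
    have hG : Gamma (((q + 2 + 2 : ℕ) : ℝ) / 2) =
        ((q + 2 : ℕ) : ℝ) / 2 * Gamma (((q + 2 : ℕ) : ℝ) / 2) := by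
      rw [← Gamma_add_one (by positivity)]
      congr 1
      push_cast
      ring
    have h2 : √2 ^ 2 = (2 : ℝ) := sq_sqrt (by norm_num)
    rw [hG, pow_add _ (q + 2) 2, h2, Nat.doubleFactorial_add_two, Nat.cast_mul]
    calc _ = ((q + 2 : ℕ) : ℝ) *
          (√(2 / π) * (√2 ^ (q + 2) * Gamma (((q + 2 : ℕ) : ℝ) / 2))) := by ring
      _ ≤ ((q + 2 : ℕ) : ℝ) * (2 * (q.doubleFactorial : ℝ)) := by gcongr
      _ = _ := by ring

lemma integrableOn_pow_mul_exp_neg_sq_div_two (n : ℕ) {B : ℝ} (hB : 0 ≤ B) :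
    IntegrableOn (fun r : ℝ ↦ r ^ n * exp (-r ^ 2 / 2)) (Set.Ioi B) := by
  have h := integrableOn_rpow_mul_exp_neg_mul_sq (b := 1 / 2) (by norm_num) (s := n)
    (by linarith [n.cast_nonneg (α := ℝ)])
  refine (h.mono_set (Set.Ioi_subset_Ioi hB)).congr_fun (fun r _ ↦ ?_) measurableSet_Ioi
  simp only [rpow_natCast]
  congr 2
  ring

lemma integral_Ioi_mul_exp_neg_sq_div_two {B : ℝ} (hB : 0 ≤ B) :
    ∫ r in Set.Ioi B, r * exp (-r ^ 2 / 2) = exp (-B ^ 2 / 2) := by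
  have hlim : Filter.Tendsto (fun r : ℝ ↦ -exp (-r ^ 2 / 2)) Filter.atTop (nhds 0) := by
    rw [← neg_zero]
    refine (tendsto_exp_atBot.comp ?_).neg
    have h : Filter.Tendsto (fun r : ℝ ↦ r ^ 2 / 2) Filter.atTop Filter.atTop :=
      (Filter.tendsto_pow_atTop two_ne_zero).atTop_div_const two_pos
    simpa only [neg_div, Function.comp_def] using Filter.tendsto_neg_atTop_atBot.comp h
  have hderiv (r : ℝ) (_ : r ∈ Set.Ici B) :
      HasDerivAt (fun r : ℝ ↦ -exp (-r ^ 2 / 2)) (r * exp (-r ^ 2 / 2)) r := by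
    refine (((hasDerivAt_pow 2 r).fun_neg.div_const 2).exp).fun_neg.congr_deriv ?_
    norm_num
    ring
  rw [integral_Ioi_of_hasDerivAt_of_tendsto' hderiv
    (by simpa using integrableOn_pow_mul_exp_neg_sq_div_two 1 hB) hlim]
  ring

lemma pow_mul_exp_le_integral_Ioi (n : ℕ) {B : ℝ} (hB : 0 ≤ B) :
    B ^ n * exp (-B ^ 2 / 2) ≤ ∫ r in Set.Ioi B, r ^ (n + 1) * exp (-r ^ 2 / 2) := by
  rw [← integral_Ioi_mul_exp_neg_sq_div_two hB, ← integral_const_mul]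
  refine setIntegral_mono_on ?_ (integrableOn_pow_mul_exp_neg_sq_div_two _ hB)
    measurableSet_Ioi fun r hr ↦ ?_
  · exact (by simpa using integrableOn_pow_mul_exp_neg_sq_div_two 1 hB :
      IntegrableOn (fun r : ℝ ↦ r * exp (-r ^ 2 / 2)) (Set.Ioi B)).const_mul _
  · have hr' : B < r := hr
    have : 0 ≤ r := hB.trans hr'.le
    rw [pow_succ r n, mul_assoc]
    gcongr

/-- The radial form of the Gaussian tail moment integral. -/
lemma integral_gaussian_tail_moment (q K : ℕ) {B : ℝ} (hB : 0 ≤ B) :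
    ∫ l in {l : EuclideanSpace ℝ (Fin (q + 2)) | B < ‖l‖},
        (2 * π) ^ (-((q + 2 : ℕ) : ℝ) / 2) * exp (-‖l‖ ^ 2 / 2) * ‖l‖ ^ K =
      2 / (√2 ^ (q + 2) * Gamma (((q + 2 : ℕ) : ℝ) / 2)) *
        ∫ r in Set.Ioi B, r ^ (q + K + 1) * exp (-r ^ 2 / 2) := by
  set c : ℝ := (2 * π) ^ (-((q + 2 : ℕ) : ℝ) / 2) with hc
  have hc' : c = (√2 ^ (q + 2) * √π ^ (q + 2))⁻¹ := by
    rw [hc, neg_div, rpow_neg (by positivity), ← mul_pow, ← sqrt_mul (by norm_num),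
      sqrt_eq_rpow, ← rpow_natCast, ← rpow_mul (by positivity)]
    congr 2
    ring
  have hmeas : MeasurableSet {l : EuclideanSpace ℝ (Fin (q + 2)) | B < ‖l‖} :=
    measurableSet_lt measurable_const measurable_norm
  have hind (l : EuclideanSpace ℝ (Fin (q + 2))) :
      {l : EuclideanSpace ℝ (Fin (q + 2)) | B < ‖l‖}.indicator
        (fun l ↦ c * exp (-‖l‖ ^ 2 / 2) * ‖l‖ ^ K) l =
      (Set.Ioi B).indicator (fun r ↦ c * exp (-r ^ 2 / 2) * r ^ K) ‖l‖ := by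
    simp [Set.indicator]
  have hrad : ∫ y in Set.Ioi (0 : ℝ),
      y ^ (q + 1) • (Set.Ioi B).indicator (fun r ↦ c * exp (-r ^ 2 / 2) * r ^ K) y =
      c * ∫ r in Set.Ioi B, r ^ (q + K + 1) * exp (-r ^ 2 / 2) := by
    rw [← integral_const_mul, ← Set.inter_eq_right.2 (Set.Ioi_subset_Ioi hB),
      ← setIntegral_indicator measurableSet_Ioi]
    refine setIntegral_congr_fun measurableSet_Ioi fun r (hr₀ : 0 < r) ↦ ?_
    by_cases hr : B < r
    · simp [Set.indicator, hr, hr₀]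
      ring
    · simp [Set.indicator, hr]
  have hG : Gamma (((q + 2 : ℕ) : ℝ) / 2 + 1) =
      ((q + 2 : ℕ) : ℝ) / 2 * Gamma (((q + 2 : ℕ) : ℝ) / 2) := Gamma_add_one (by positivity)
  have hGpos : 0 < Gamma (((q + 2 : ℕ) : ℝ) / 2) := Gamma_pos_of_pos (by positivity)
  have hvol : volume.real (Metric.ball (0 : EuclideanSpace ℝ (Fin (q + 2))) 1) =
      √π ^ (q + 2) / (((q + 2 : ℕ) : ℝ) / 2 * Gamma (((q + 2 : ℕ) : ℝ) / 2)) := by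
    rw [Measure.real, EuclideanSpace.volume_ball, Fintype.card_fin, hG, ENNReal.ofReal_one,
      one_pow, one_mul, ENNReal.toReal_ofReal (by positivity)]
  rw [← integral_indicator hmeas, integral_congr_ae (.of_forall hind),
    integral_fun_norm_addHaar volume
      ((Set.Ioi B).indicator fun r ↦ c * exp (-r ^ 2 / 2) * r ^ K),
    finrank_euclideanSpace_fin, show q + 2 - 1 = q + 1 from rfl, hrad, hvol, hc', nsmul_eq_mul,
    smul_eq_mul]
  have hpi : √π ≠ 0 := (sqrt_pos.2 pi_pos).ne'
  have hq : ((q + 2 : ℕ) : ℝ) ≠ 0 := by positivity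
  field_simp

/-- Lower-bound half of the tail moment control lemma for the p-dimensional
standard normal distribution. -/
theorem gaussian_tail_moment_lower (p K : ℕ) (hp : 2 ≤ p) (B : ℝ) (hB : 0 < B) :
    Real.sqrt (2 / π) * B ^ (p + K - 2) * Real.exp (-B ^ 2 / 2) /
        (Nat.doubleFactorial (p - 2) : ℝ)
      ≤ ∫ l in {l : EuclideanSpace ℝ (Fin p) | B < ‖l‖},
          (2 * π) ^ (-(p : ℝ) / 2) * Real.exp (-‖l‖ ^ 2 / 2) * ‖l‖ ^ K := by
  obtain ⟨q, rfl⟩ := Nat.exists_eq_add_of_le' hp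
  rw [integral_gaussian_tail_moment q K hB.le, show q + 2 + K - 2 = q + K by omega,
    Nat.add_sub_cancel]
  have hGpos : 0 < Gamma (((q + 2 : ℕ) : ℝ) / 2) := Gamma_pos_of_pos (by positivity)
  have hfact : (0 : ℝ) < q.doubleFactorial := by exact_mod_cast q.doubleFactorial_pos
  calc _ = √(2 / π) / q.doubleFactorial * (B ^ (q + K) * exp (-B ^ 2 / 2)) := by ring
    _ ≤ _ := by
      refine mul_le_mul ?_ (pow_mul_exp_le_integral_Ioi _ hB.le) (by positivity) (by positivity)
      rw [div_le_div_iff₀ hfact (by positivity)]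
      exact sqrt_two_pow_mul_Gamma_le_doubleFactorial q
end

section
/- Let m ≥ 1 be a real number, B > 0, and α ∈ [0,1) with m - 1 ≤ α·B². Then ∫_B^∞ r^m e^{-r²/2} dr ≤ B^{m-1} e^{-B²/2} / (1-α). -/
open MeasureTheory Real

/-- The function `r ^ s * exp (-r ^ 2 / 2)` tends to `0` at infinity. -/
lemma tendsto_rpow_mul_exp_neg_sq_div_two (s : ℝ) :
    Filter.Tendsto (fun r : ℝ => r ^ s * Real.exp (-r ^ 2 / 2)) Filter.atTop (nhds 0) := by
  have h := (rpow_mul_exp_neg_mul_sq_isLittleO_exp_neg (b := 1 / 2) one_half_pos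
    s).tendsto_zero_of_tendsto
      (tendsto_exp_atBot.comp <|
        Filter.tendsto_id.const_mul_atTop_of_neg (neg_lt_zero.mpr one_half_pos))
  refine h.congr fun r => ?_
  congr 2
  ring

lemma hasDerivAt_rpow_mul_exp_neg_sq_div_two (s : ℝ) {r : ℝ} (hr : r ≠ 0) :
    HasDerivAt (fun r : ℝ => r ^ s * Real.exp (-r ^ 2 / 2))
      ((s - r ^ 2) * r ^ (s - 1) * Real.exp (-r ^ 2 / 2)) r := by
  have hexp : HasDerivAt (fun r : ℝ => Real.exp (-r ^ 2 / 2))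
      (Real.exp (-r ^ 2 / 2) * (-r)) r := by
    refine ((hasDerivAt_pow 2 r).fun_neg.div_const 2).exp.congr_deriv ?_
    norm_num
    ring
  refine ((hasDerivAt_rpow_const (p := s) (Or.inl hr)).mul hexp).congr_deriv ?_
  rw [rpow_sub_one hr]
  field_simp
  ring

/-- Gaussian-type tail upper estimate. -/
theorem gaussian_type_tail_upper (m B α : ℝ) (hm : 1 ≤ m) (hB : 0 < B)
    (hα0 : 0 ≤ α) (hα1 : α < 1) (h : m - 1 ≤ α * B ^ 2) :
    ∫ r in Set.Ioi B, r ^ m * Real.exp (-r ^ 2 / 2)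
      ≤ B ^ (m - 1) * Real.exp (-B ^ 2 / 2) / (1 - α) := by
  have hα : 0 < 1 - α := sub_pos.mpr hα1
  have hderiv : ∀ r ∈ Set.Ici B,
      HasDerivAt (fun r : ℝ => -(r ^ (m - 1) * Real.exp (-r ^ 2 / 2)))
        (-((m - 1 - r ^ 2) * r ^ (m - 1 - 1) * Real.exp (-r ^ 2 / 2))) r := fun r hr =>
    (hasDerivAt_rpow_mul_exp_neg_sq_div_two (m - 1) (hB.trans_le hr).ne').neg
  have hle : ∀ r ∈ Set.Ioi B, (1 - α) * (r ^ m * Real.exp (-r ^ 2 / 2)) ≤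
      -((m - 1 - r ^ 2) * r ^ (m - 1 - 1) * Real.exp (-r ^ 2 / 2)) := by
    intro r hr
    have hr0 : 0 < r := hB.trans hr
    have hpow : r ^ m = r ^ 2 * r ^ (m - 1 - 1) := by
      rw [← rpow_two, ← rpow_add hr0]
      ring_nf
    have hmr : m - 1 ≤ α * r ^ 2 := h.trans (by gcongr; exact le_of_lt hr)
    have hpos : 0 ≤ r ^ (m - 1 - 1) * Real.exp (-r ^ 2 / 2) := by positivity
    rw [hpow]
    linarith [mul_le_mul_of_nonneg_right hmr hpos]
  have hnonneg : ∀ r ∈ Set.Ioi B, 0 ≤ (1 - α) * (r ^ m * Real.exp (-r ^ 2 / 2)) := by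
    intro r hr
    have hr0 : 0 < r := hB.trans hr
    positivity
  have htendsto := (tendsto_rpow_mul_exp_neg_sq_div_two (m - 1)).neg
  have hint := integrableOn_Ioi_deriv_of_nonneg' hderiv
    (fun r hr => (hnonneg r hr).trans (hle r hr)) htendsto
  have hmono := integral_mono_of_nonneg
    ((ae_restrict_iff' measurableSet_Ioi).mpr (ae_of_all _ hnonneg)) hint
    ((ae_restrict_iff' measurableSet_Ioi).mpr (ae_of_all _ hle))
  rw [integral_const_mul, integral_Ioi_of_hasDerivAt_of_tendsto' hderiv hint htendsto] at hmono
  rw [le_div_iff₀ hα]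
  linarith
end

section
/- For all x, a, b ∈ ℝ^p (p ≥ 1 an integer), exp(-‖x-a‖²/2 - ‖x-b‖²/2) / ( exp(-‖x-a‖²/2) + exp(-‖x-b‖²/2) ) ≤ (1/2) · exp(-‖x-(a+b)/2‖²/2) · exp(-‖a-b‖²/8). -/
open Real

/-- The harmonic mean of two exponentials is at most their geometric mean. -/
theorem exp_add_div_exp_add_exp_le (u v : ℝ) :
    Real.exp (u + v) / (Real.exp u + Real.exp v) ≤ 1 / 2 * Real.exp ((u + v) / 2) := by
  have hu : Real.exp u = Real.exp (u / 2) ^ 2 := by rw [sq, ← Real.exp_add, add_halves]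
  have hv : Real.exp v = Real.exp (v / 2) ^ 2 := by rw [sq, ← Real.exp_add, add_halves]
  rw [Real.exp_add, add_div, Real.exp_add, hu, hv, div_le_iff₀ (by positivity)]
  have hst : 0 ≤ Real.exp (u / 2) * Real.exp (v / 2) := by positivity
  nlinarith [mul_nonneg hst (sq_nonneg (Real.exp (u / 2) - Real.exp (v / 2)))]

/-- Apollonius' identity for the midpoint of `a` and `b`. -/
theorem norm_sub_sq_add_norm_sub_sq {E : Type*} [NormedAddCommGroup E] [InnerProductSpace ℝ E]
    (x a b : E) :
    ‖x - a‖ ^ 2 + ‖x - b‖ ^ 2 = 2 * ‖x - ((1 : ℝ) / 2) • (a + b)‖ ^ 2 + ‖a - b‖ ^ 2 / 2 := by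
  have h := parallelogram_law_with_norm ℝ (x - a) (x - b)
  have hadd : x - a + (x - b) = (2 : ℝ) • (x - ((1 : ℝ) / 2) • (a + b)) := by module
  have hsub : x - a - (x - b) = -(a - b) := by abel
  rw [hadd, hsub, norm_neg, norm_smul, Real.norm_ofNat] at h
  linarith

/-- Pointwise estimate combining the parallelogram identity with the
arithmetic–geometric mean bound, used to bound the Gaussian mixture
information matrix. -/
theorem gmm_cross_term_pointwise_bound (p : ℕ) (hp : 1 ≤ p)
    (x a b : EuclideanSpace ℝ (Fin p)) :
    Real.exp (-‖x - a‖ ^ 2 / 2 - ‖x - b‖ ^ 2 / 2) /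
        (Real.exp (-‖x - a‖ ^ 2 / 2) + Real.exp (-‖x - b‖ ^ 2 / 2))
      ≤ (1 / 2) * Real.exp (-‖x - ((1 : ℝ) / 2) • (a + b)‖ ^ 2 / 2) *
        Real.exp (-‖a - b‖ ^ 2 / 8) := by
  have h := norm_sub_sq_add_norm_sub_sq x a b
  rw [mul_assoc, ← Real.exp_add, sub_eq_add_neg, ← neg_div]
  convert exp_add_div_exp_add_exp_le (-‖x - a‖ ^ 2 / 2) (-‖x - b‖ ^ 2 / 2) using 3
  linarith
end

section
/- Fix integers p ≥ 1 and K ≥ 2 and means μ_1, …, μ_K ∈ ℝ^p. Let p⁰(x) = (1/K) ∑_{l=1}^K (2π)^{-p/2} exp(-‖x-μ_l‖²/2) and w_k(x) = exp(-‖x-μ_k‖²/2) / ∑_{l=1}^K exp(-‖x-μ_l‖²/2). Then for all indices k₁ ≠ k₂, ∫_{ℝ^p} w_{k₁}(x) · w_{k₂}(x) · ( ‖x-μ_{k₁}‖² + ‖x-μ_{k₂}‖² ) · p⁰(x) dx ≤ ( ‖μ_{k₁}-μ_{k₂}‖² + 4p ) / (4K) · exp( -‖μ_{k₁}-μ_{k₂}‖²/8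 ). -/
open MeasureTheory Real

section GaussianMoments

variable {E : Type*} [NormedAddCommGroup E] [InnerProductSpace ℝ E] [FiniteDimensional ℝ E]
  [MeasurableSpace E] [BorelSpace E]

theorem integrable_exp_neg_norm_sq_div_two :
    Integrable fun x : E ↦ exp (-‖x‖ ^ 2 / 2) := by
  have h := (GaussianFourier.integrable_cexp_neg_mul_sq_norm_add (V := E) (b := 1 / 2)
    (by norm_num) 0 0).norm
  refine h.congr (.of_forall fun x ↦ ?_)
  simp only [Complex.norm_exp]
  congr 1
  simp [← Complex.ofReal_pow]
  ring

theorem integral_exp_neg_norm_sq_div_two :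
    ∫ x : E, exp (-‖x‖ ^ 2 / 2) = (2 * π) ^ ((Module.finrank ℝ E : ℝ) / 2) := by
  have h := GaussianFourier.integral_rexp_neg_mul_sq_norm (V := E) (b := 1 / 2) (by norm_num)
  rw [show π / (1 / 2) = 2 * π by ring] at h
  rw [← h]
  congr with x
  ring_nf

variable [Nontrivial E]

theorem integrable_norm_sq_mul_exp_neg_norm_sq_div_two :
    Integrable fun x : E ↦ ‖x‖ ^ 2 * exp (-‖x‖ ^ 2 / 2) := by
  rw [integrable_fun_norm_addHaar volume (f := fun r : ℝ ↦ r ^ 2 * exp (-r ^ 2 / 2))]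
  have h := integrableOn_rpow_mul_exp_neg_mul_rpow (p := 2) (b := 1 / 2)
    (s := ((Module.finrank ℝ E - 1 + 2 : ℕ) : ℝ))
    (by linarith [Nat.cast_nonneg (α := ℝ) (Module.finrank ℝ E - 1 + 2)])
    (by norm_num) (by norm_num)
  refine h.congr_fun (fun r _ ↦ ?_) measurableSet_Ioi
  simp only [rpow_natCast, rpow_two, smul_eq_mul, pow_add]
  ring_nf

/-- The second moment of a standard Gaussian is the dimension. -/
theorem integral_norm_sq_mul_exp_neg_norm_sq_div_two :
    ∫ x : E, ‖x‖ ^ 2 * exp (-‖x‖ ^ 2 / 2) =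
      Module.finrank ℝ E * (2 * π) ^ ((Module.finrank ℝ E : ℝ) / 2) := by
  rw [← integral_exp_neg_norm_sq_div_two,
    integral_fun_norm_addHaar volume (fun r : ℝ ↦ r ^ 2 * exp (-r ^ 2 / 2)),
    integral_fun_norm_addHaar volume (fun r : ℝ ↦ exp (-r ^ 2 / 2))]
  obtain ⟨n, hn⟩ : ∃ n, Module.finrank ℝ E = n + 1 :=
    Nat.exists_eq_succ_of_ne_zero Module.finrank_pos.ne'
  have radial (k : ℕ) : ∫ r in Set.Ioi (0 : ℝ), r ^ k * exp (-r ^ 2 / 2) =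
      (1 / 2 : ℝ) ^ (-((k : ℝ) + 1) / 2) * (1 / 2) * Gamma (((k : ℝ) + 1) / 2) := by
    rw [← integral_rpow_mul_exp_neg_mul_rpow (p := 2) (q := k) (b := 1 / 2) (by norm_num)
      (by linarith [Nat.cast_nonneg (α := ℝ) k]) (by norm_num)]
    refine setIntegral_congr_fun measurableSet_Ioi fun r _ ↦ ?_
    simp only [rpow_natCast, rpow_two]
    ring_nf
  have moment : ∫ r in Set.Ioi (0 : ℝ), r ^ (n + 2) * exp (-r ^ 2 / 2) =
      (n + 1) * ∫ r in Set.Ioi (0 : ℝ), r ^ n * exp (-r ^ 2 / 2) := by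
    rw [radial, radial]
    have hpos : (0 : ℝ) < ((n : ℝ) + 1) / 2 := by positivity
    rw [show (((n + 2 : ℕ) : ℝ) + 1) / 2 = ((n : ℝ) + 1) / 2 + 1 by push_cast; ring,
      Gamma_add_one hpos.ne',
      show -(((n + 2 : ℕ) : ℝ) + 1) / 2 = -((n : ℝ) + 1) / 2 - 1 by push_cast; ring,
      rpow_sub_one (by norm_num)]
    ring
  simp only [hn, Nat.add_sub_cancel, smul_eq_mul, ← mul_assoc, ← pow_add, moment, nsmul_eq_mul]
  push_cast
  ring

end GaussianMoments

theorem norm_sub_sq_add_norm_sub_sq_eq_midpoint {E : Type*} [NormedAddCommGroup E]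
    [InnerProductSpace ℝ E] (x a b : E) :
    ‖x - a‖ ^ 2 + ‖x - b‖ ^ 2 = 2 * ‖x - midpoint ℝ a b‖ ^ 2 + ‖a - b‖ ^ 2 / 2 := by
  have h := parallelogram_law_with_norm ℝ (x - a) (x - b)
  have h₁ : x - a + (x - b) = (2 : ℝ) • (x - midpoint ℝ a b) := by
    rw [midpoint_eq_smul_add, invOf_eq_inv]; module
  have h₂ : x - a - (x - b) = -(a - b) := by abel
  rw [h₁, h₂, norm_neg, norm_smul, norm_two] at h
  linarith

/-- The responsibilities' product times the total weight `S` is dominated by half a geometric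
mean, by AM-GM applied to the two components. -/
theorem exp_div_mul_exp_div_mul_le {u v S : ℝ} (hS : exp u + exp v ≤ S) :
    exp u / S * (exp v / S) * S ≤ exp ((u + v) / 2) / 2 := by
  have hu : exp u = exp (u / 2) ^ 2 := by rw [← exp_nat_mul]; congr 1; push_cast; ring
  have hv : exp v = exp (v / 2) ^ 2 := by rw [← exp_nat_mul]; congr 1; push_cast; ring
  have hm : exp ((u + v) / 2) = exp (u / 2) * exp (v / 2) := by rw [← exp_add]; congr 1; ring
  have hpos : 0 < S := lt_of_lt_of_le (by positivity) hS
  rw [show exp u / S * (exp v / S) * S = exp u * exp v / S by field_simp, div_le_iff₀ hpos]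
  rw [hu, hv] at hS ⊢
  rw [hm]
  have := two_mul_le_add_sq (exp (u / 2)) (exp (v / 2))
  have hg : 0 < exp (u / 2) * exp (v / 2) := by positivity
  nlinarith [mul_le_mul_of_nonneg_left (this.trans hS) hg.le]

/-- Bound on the expected cross-responsibility second moment of the
equal-weight, identity-covariance Gaussian mixture model. -/
theorem gmm_cross_responsibility_bound (p K : ℕ) (hp : 1 ≤ p) (hK : 2 ≤ K)
    (μ : Fin K → EuclideanSpace ℝ (Fin p)) (k₁ k₂ : Fin K) (hne : k₁ ≠ k₂) :
    ∫ x : EuclideanSpace ℝ (Fin p),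
        (Real.exp (-‖x - μ k₁‖ ^ 2 / 2) / ∑ l, Real.exp (-‖x - μ l‖ ^ 2 / 2)) *
        (Real.exp (-‖x - μ k₂‖ ^ 2 / 2) / ∑ l, Real.exp (-‖x - μ l‖ ^ 2 / 2)) *
        (‖x - μ k₁‖ ^ 2 + ‖x - μ k₂‖ ^ 2) *
        ((1 / (K : ℝ)) * ∑ l, (2 * π) ^ (-(p : ℝ) / 2) *
          Real.exp (-‖x - μ l‖ ^ 2 / 2))
      ≤ (‖μ k₁ - μ k₂‖ ^ 2 + 4 * p) / (4 * K) *
        Real.exp (-‖μ k₁ - μ k₂‖ ^ 2 / 8) := by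
  have : NeZero p := ⟨by omega⟩
  have hK₀ : (0 : ℝ) < K := by exact_mod_cast (by omega : 0 < K)
  set d := ‖μ k₁ - μ k₂‖ ^ 2 with hd
  set m := midpoint ℝ (μ k₁) (μ k₂)
  set c : ℝ := (2 * π) ^ (-(p : ℝ) / 2) with hc
  have hc₀ : 0 < c := by positivity
  set A : ℝ := c / (2 * K) * exp (-d / 8) with hA
  let g : EuclideanSpace ℝ (Fin p) → ℝ := fun y ↦
    A * (2 * (‖y‖ ^ 2 * exp (-‖y‖ ^ 2 / 2)) + d / 2 * exp (-‖y‖ ^ 2 / 2))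
  have hi₁ := integrable_norm_sq_mul_exp_neg_norm_sq_div_two (E := EuclideanSpace ℝ (Fin p))
  have hi₂ := integrable_exp_neg_norm_sq_div_two (E := EuclideanSpace ℝ (Fin p))
  have hg : Integrable g := ((hi₁.const_mul 2).add (hi₂.const_mul (d / 2))).const_mul A
  calc
    _ ≤ ∫ x, g (x - m) := by
      refine integral_mono_of_nonneg (.of_forall fun x ↦ by positivity) (hg.comp_sub_right m)
        (.of_forall fun x ↦ ?_)
      have hS : exp (-‖x - μ k₁‖ ^ 2 / 2) + exp (-‖x - μ k₂‖ ^ 2 / 2) ≤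
          ∑ l, exp (-‖x - μ l‖ ^ 2 / 2) := by
        rw [← Finset.sum_pair hne (f := fun l ↦ exp (-‖x - μ l‖ ^ 2 / 2))]
        exact Finset.sum_le_sum_of_subset_of_nonneg (Finset.subset_univ _)
          fun _ _ _ ↦ (exp_pos _).le
      have hsq := norm_sub_sq_add_norm_sub_sq_eq_midpoint x (μ k₁) (μ k₂)
      have hexp : exp ((-‖x - μ k₁‖ ^ 2 / 2 + -‖x - μ k₂‖ ^ 2 / 2) / 2) =
          exp (-‖x - m‖ ^ 2 / 2) * exp (-d / 8) := by
        rw [← exp_add]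
        congr 1
        linarith
      have hw := exp_div_mul_exp_div_mul_le hS
      rw [hexp] at hw
      have hq : 0 ≤ (‖x - μ k₁‖ ^ 2 + ‖x - μ k₂‖ ^ 2) * (c / K) := by positivity
      have h := mul_le_mul_of_nonneg_right hw hq
      simp only [← Finset.mul_sum]
      refine (le_of_eq ?_).trans (h.trans_eq ?_)
      · ring
      · simp only [g, hA, hsq, hd, m]
        field_simp
    _ = A * (2 * (p * (2 * π) ^ ((p : ℝ) / 2)) + d / 2 * (2 * π) ^ ((p : ℝ) / 2)) := by
      rw [integral_sub_right_eq_self g m, integral_const_mul,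
        integral_add (hi₁.const_mul 2) (hi₂.const_mul (d / 2)), integral_const_mul,
        integral_const_mul, integral_norm_sq_mul_exp_neg_norm_sq_div_two,
        integral_exp_neg_norm_sq_div_two, finrank_euclideanSpace_fin]
    _ = _ := by
      have hcinv : c * (2 * π) ^ ((p : ℝ) / 2) = 1 := by
        rw [hc, ← rpow_add (by positivity)]
        simp [neg_div]
      rw [hA]
      linear_combination (2 * p + d / 2) / (2 * K) * exp (-d / 8) * hcinv
end
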